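/- Let U and V be independent standard Gaussian random variables, let n be a nonnegative integer and r a positive integer. Then for every γ ∈ (0, 1) with γ ≠ 1/2, E[U^{2n} V^{2n} (γU² − (1−γ)V²)^{2r}] > 2^{2n+2r} · (1/2)_n · (1/2)_{n+r} · (1/2)_r; that is, the function γ ↦ E[U^{2n} V^{2n} (γU² − (1−γ)V²)^{2r}] attains its unique minimum on (0,1) at γ = 1/2. -/

import Mathlib

open MeasureTheory ProbabilityTheory

/-- The rising factorial `(α)_k = α (α+1) ⋯ (α+k-1)`, with `(α)_0 = 1`. -/
def risingFactorial (α : ℝ) (k : ℕ) : ℝ := ∏ j ∈ Finset.range k, (α + j)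

/-- The product of two standard Gaussian measures, written through its joint density. -/
lemma integral_gaussianReal_prod (f : ℝ × ℝ → ℝ) :
    ∫ z, f z ∂((gaussianReal 0 1).prod (gaussianReal 0 1)) =
      (2 * Real.pi)⁻¹ * ∫ z : ℝ × ℝ, Real.exp (-(z.1 ^ 2 + z.2 ^ 2) / 2) * f z := by
  have hm : Measurable (gaussianPDF 0 1) := measurable_gaussianPDF 0 1
  rw [gaussianReal_of_var_ne_zero 0 one_ne_zero, prod_withDensity hm hm,
    integral_withDensity_eq_integral_toReal_smul (by fun_prop)
      (Filter.Eventually.of_forall fun z => by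
        exact ENNReal.mul_lt_top gaussianPDF_lt_top gaussianPDF_lt_top),
    ← integral_const_mul]
  refine integral_congr_ae (Filter.Eventually.of_forall fun z => ?_)
  have hs : (√(2 * Real.pi))⁻¹ * (√(2 * Real.pi))⁻¹ = (2 * Real.pi)⁻¹ := by
    rw [← mul_inv, Real.mul_self_sqrt (by positivity)]
  have he : Real.exp (-(z.1 ^ 2 + z.2 ^ 2) / 2) =
      Real.exp (-z.1 ^ 2 / 2) * Real.exp (-z.2 ^ 2 / 2) := by
    rw [← Real.exp_add]
    ring_nf
  simp only [ENNReal.toReal_mul, toReal_gaussianPDF, gaussianPDFReal, smul_eq_mul, NNReal.coe_one,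
    mul_one, sub_zero]
  rw [he, ← hs]
  ring

/-- Radial moments of the two-dimensional Gaussian weight. -/
lemma integral_Ioi_pow_mul_exp_neg_sq_div_two (k : ℕ) :
    ∫ x in Set.Ioi (0 : ℝ), x ^ (2 * k + 1) * Real.exp (-x ^ 2 / 2) = 2 ^ k * k.factorial := by
  have h := integral_rpow_mul_exp_neg_mul_rpow (p := 2) (q := ((2 * k + 1 : ℕ) : ℝ)) (b := 1 / 2)
    (by norm_num) (by linarith [Nat.cast_nonneg (α := ℝ) (2 * k + 1)]) (by norm_num)
  have he : (((2 * k + 1 : ℕ) : ℝ) + 1) / 2 = (k : ℝ) + 1 := by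
    push_cast
    ring
  have hb : ((1 : ℝ) / 2) ^ (-(((2 * k + 1 : ℕ) : ℝ) + 1) / 2) = 2 ^ (k + 1) := by
    rw [neg_div, he, one_div, Real.inv_rpow (by norm_num), Real.rpow_neg (by norm_num), inv_inv,
      ← Real.rpow_natCast]
    push_cast
    rfl
  rw [hb, he, Real.Gamma_nat_eq_factorial] at h
  calc
    _ = ∫ x in Set.Ioi (0 : ℝ),
        x ^ (((2 * k + 1 : ℕ) : ℝ)) * Real.exp (-(1 / 2) * x ^ (2 : ℝ)) := by
      refine integral_congr_ae (Filter.Eventually.of_forall fun x => ?_)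
      simp only [Real.rpow_natCast, Real.rpow_two]
      ring_nf
    _ = _ := by
      rw [h]
      ring

/-- The Gaussian expectation of a homogeneous function factors in polar coordinates. -/
lemma integral_gaussianReal_prod_of_homogeneous (f : ℝ × ℝ → ℝ) (g : ℝ → ℝ) (k : ℕ)
    (hf : ∀ x θ, f (x * Real.cos θ, x * Real.sin θ) = x ^ (2 * k) * g θ) :
    ∫ z, f z ∂((gaussianReal 0 1).prod (gaussianReal 0 1)) =
      (2 * Real.pi)⁻¹ * (2 ^ k * k.factorial * ∫ θ in -Real.pi..Real.pi, g θ) := by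
  rw [integral_gaussianReal_prod, ← integral_comp_polarCoord_symm, polarCoord_target,
    Measure.volume_eq_prod, ← Measure.prod_restrict, ← integral_Ioi_pow_mul_exp_neg_sq_div_two,
    intervalIntegral.integral_of_le (by linarith [Real.pi_pos]), integral_Ioc_eq_integral_Ioo,
    ← integral_prod_mul]
  congr 1
  refine integral_congr_ae (Filter.Eventually.of_forall fun z => ?_)
  have hz : (z.1 * Real.cos z.2) ^ 2 + (z.1 * Real.sin z.2) ^ 2 = z.1 ^ 2 := by
    rw [mul_pow, mul_pow, ← mul_add, Real.cos_sq_add_sin_sq, mul_one]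
  simp only [polarCoord_symm_apply, hf, hz, smul_eq_mul]
  ring

lemma Gamma_nat_add_one_half (k : ℕ) :
    Real.Gamma (k + 1 / 2) = risingFactorial (1 / 2) k * √Real.pi := by
  induction k with
  | zero => simp [risingFactorial, Real.Gamma_one_half_eq, -one_div]
  | succ k ih =>
    rw [risingFactorial, Finset.prod_range_succ, ← risingFactorial]
    push_cast
    rw [add_right_comm, Real.Gamma_add_one (by positivity), ih]
    ring

lemma integral_even_pow_gaussianReal (k : ℕ) :
    ∫ x, x ^ (2 * k) ∂(gaussianReal 0 1) = 2 ^ k * risingFactorial (1 / 2) k := by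
  have h := integral_rpow_mul_exp_neg_mul_rpow (p := 2) (q := ((2 * k : ℕ) : ℝ)) (b := 1 / 2)
    (by norm_num) (by linarith [Nat.cast_nonneg (α := ℝ) (2 * k)]) (by norm_num)
  have he : (((2 * k : ℕ) : ℝ) + 1) / 2 = (k : ℝ) + 1 / 2 := by
    push_cast
    ring
  have hb : ((1 : ℝ) / 2) ^ (-(((2 * k : ℕ) : ℝ) + 1) / 2) = 2 ^ k * √2 := by
    rw [neg_div, he, one_div, Real.inv_rpow (by norm_num), Real.rpow_neg (by norm_num), inv_inv,
      Real.rpow_add (by norm_num), Real.rpow_natCast, Real.sqrt_eq_rpow, one_div]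
  rw [hb, he, Gamma_nat_add_one_half] at h
  have habs := integral_comp_abs (f := fun x : ℝ => x ^ (2 * k) * Real.exp (-x ^ 2 / 2))
  simp only [(even_two_mul k).pow_abs, sq_abs] at habs
  have hI : ∫ x in Set.Ioi (0 : ℝ), x ^ (2 * k) * Real.exp (-x ^ 2 / 2) =
      ∫ x in Set.Ioi (0 : ℝ), x ^ (((2 * k : ℕ) : ℝ)) * Real.exp (-(1 / 2) * x ^ (2 : ℝ)) := by
    refine integral_congr_ae (Filter.Eventually.of_forall fun x => ?_)
    simp only [Real.rpow_natCast, Real.rpow_two]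
    ring_nf
  rw [integral_gaussianReal_eq_integral_smul one_ne_zero]
  have hs : (√(2 * Real.pi))⁻¹ * (√2 * √Real.pi) = 1 := by
    rw [← Real.sqrt_mul (by norm_num)]
    exact inv_mul_cancel₀ (by positivity)
  calc
    _ = (√(2 * Real.pi))⁻¹ * ∫ x : ℝ, x ^ (2 * k) * Real.exp (-x ^ 2 / 2) := by
      rw [← integral_const_mul]
      refine integral_congr_ae (Filter.Eventually.of_forall fun x => ?_)
      simp only [gaussianPDFReal, smul_eq_mul, NNReal.coe_one, mul_one, sub_zero]
      ring
    _ = 2 ^ k * risingFactorial (1 / 2) k * ((√(2 * Real.pi))⁻¹ * (√2 * √Real.pi)) := by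
      rw [habs, hI, h]
      ring
    _ = _ := by rw [hs, mul_one]

lemma factorial_two_mul_eq_risingFactorial (k : ℕ) :
    ((2 * k).factorial : ℝ) = 4 ^ k * risingFactorial (1 / 2) k * k.factorial := by
  induction k with
  | zero => simp [risingFactorial]
  | succ k ih =>
    rw [risingFactorial, Finset.prod_range_succ, ← risingFactorial, Nat.mul_succ,
      Nat.factorial_succ, Nat.factorial_succ, Nat.factorial_succ]
    push_cast
    rw [ih]
    ring

lemma intervalIntegral_comp_two_mul_of_periodic (g : ℝ → ℝ) (hg : Continuous g)
    (hp : Function.Periodic g (2 * Real.pi)) :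
    ∫ θ in -Real.pi..Real.pi, g (2 * θ) = ∫ θ in -Real.pi..Real.pi, g θ := by
  rw [intervalIntegral.integral_comp_mul_left g two_ne_zero,
    ← intervalIntegral.integral_add_adjacent_intervals (b := 0)
      (hg.intervalIntegrable _ _) (hg.intervalIntegrable _ _)]
  have h1 := hp.intervalIntegral_add_eq (2 * -Real.pi) (-Real.pi)
  have h2 := hp.intervalIntegral_add_eq 0 (-Real.pi)
  rw [show 2 * -Real.pi + 2 * Real.pi = 0 by ring,
    show -Real.pi + 2 * Real.pi = Real.pi by ring] at h1
  rw [zero_add, show -Real.pi + 2 * Real.pi = Real.pi by ring] at h2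
  rw [h1, h2, smul_eq_mul]
  ring

lemma integral_gaussianReal_prod_half (n r : ℕ) :
    ∫ z : ℝ × ℝ, z.1 ^ (2 * n) * z.2 ^ (2 * n) *
        ((1 / 2 : ℝ) * z.1 ^ 2 - (1 - 1 / 2) * z.2 ^ 2) ^ (2 * r)
        ∂((gaussianReal 0 1).prod (gaussianReal 0 1)) =
      2 ^ (2 * n + 2 * r) * risingFactorial (1 / 2) n *
        risingFactorial (1 / 2) (n + r) * risingFactorial (1 / 2) r := by
  let g : ℝ → ℝ := fun θ => Real.cos θ ^ (2 * r) * Real.sin θ ^ (2 * n)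
  have hmom := integral_gaussianReal_prod_of_homogeneous
    (fun z => z.1 ^ (2 * r) * z.2 ^ (2 * n)) g (n + r) (fun x θ => by simp only [g]; ring)
  rw [integral_prod_mul (fun x : ℝ => x ^ (2 * r)) (fun x : ℝ => x ^ (2 * n)),
    integral_even_pow_gaussianReal, integral_even_pow_gaussianReal] at hmom
  have hval := integral_gaussianReal_prod_of_homogeneous
    (fun z => z.1 ^ (2 * n) * z.2 ^ (2 * n) *
        ((1 / 2 : ℝ) * z.1 ^ 2 - (1 - 1 / 2) * z.2 ^ 2) ^ (2 * r))
    (fun θ => (1 / 2) ^ (2 * (n + r)) * g (2 * θ)) (2 * (n + r)) (fun x θ => by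
      simp only [g]
      rw [Real.sin_two_mul, Real.cos_two_mul']
      have h : (1 / 2 : ℝ) * (x * Real.cos θ) ^ 2 - (1 - 1 / 2) * (x * Real.sin θ) ^ 2 =
          (1 / 2) * x ^ 2 * (Real.cos θ ^ 2 - Real.sin θ ^ 2) := by ring
      rw [h, mul_pow, mul_pow, mul_pow, mul_pow, mul_pow, mul_pow (2 : ℝ),
        show (1 / 2 : ℝ) ^ (2 * (n + r)) = (1 / 2) ^ (2 * n) * (1 / 2) ^ (2 * r) by ring]
      have h2 : (1 / 2 : ℝ) ^ (2 * n) * 2 ^ (2 * n) = 1 := by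
        rw [← mul_pow]
        norm_num
      linear_combination (-(x ^ (4 * n + 4 * r) * Real.cos θ ^ (2 * n) * Real.sin θ ^ (2 * n) *
        (1 / 2) ^ (2 * r) * (Real.cos θ ^ 2 - Real.sin θ ^ 2) ^ (2 * r))) * h2)
  have hg : Continuous g := by
    simp only [g]
    fun_prop
  have hp : Function.Periodic g (2 * Real.pi) := fun θ => by
    simp only [g, Real.cos_add_two_pi, Real.sin_add_two_pi]
  rw [hval, intervalIntegral.integral_const_mul, intervalIntegral_comp_two_mul_of_periodic g hg hp,
    factorial_two_mul_eq_risingFactorial]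
  have h2 : (1 / 2 : ℝ) ^ (2 * (n + r)) * 2 ^ (2 * (n + r)) = 1 := by
    rw [← mul_pow]
    norm_num
  have h4 : (4 : ℝ) ^ (n + r) = 2 ^ (n + r) * 2 ^ (n + r) := by
    rw [← mul_pow]
    norm_num
  have h5 : (2 : ℝ) ^ (2 * n + 2 * r) = 2 ^ (n + r) * (2 ^ n * 2 ^ r) := by ring
  calc
    _ = ((1 / 2 : ℝ) ^ (2 * (n + r)) * 2 ^ (2 * (n + r))) * 2 ^ (n + r) *
        risingFactorial (1 / 2) (n + r) * ((2 * Real.pi)⁻¹ * (2 ^ (n + r) * (n + r).factorial *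
          ∫ θ in -Real.pi..Real.pi, g θ)) := by
      rw [h4]
      ring
    _ = _ := by
      rw [h2, ← hmom, h5]
      ring

lemma integrable_gaussianReal_prod (n r : ℕ) (a b : ℝ) :
    Integrable (fun z : ℝ × ℝ => z.1 ^ (2 * n) * z.2 ^ (2 * n) *
      (a * z.1 ^ 2 - b * z.2 ^ 2) ^ (2 * r)) ((gaussianReal 0 1).prod (gaussianReal 0 1)) := by
  have hpow (k : ℕ) : Integrable (fun x : ℝ => x ^ k) (gaussianReal 0 1) := by
    have h := (memLp_id_gaussianReal (μ := 0) (v := 1) (k : NNReal)).integrable_norm_pow' (p := k)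
    exact (integrable_norm_iff (by fun_prop)).1 (by simpa using h)
  have hmon (j k : ℕ) : Integrable (fun z : ℝ × ℝ => z.1 ^ j * z.2 ^ k)
      ((gaussianReal 0 1).prod (gaussianReal 0 1)) := (hpow j).mul_prod (hpow k)
  simp_rw [sub_eq_add_neg, add_pow, Finset.mul_sum]
  refine integrable_finsetSum _ fun i _ => ?_
  refine ((hmon (2 * n + 2 * i) (2 * n + 2 * (2 * r - i))).const_mul
    (a ^ i * (-b) ^ (2 * r - i) * ((2 * r).choose i : ℝ))).congr
    (Filter.Eventually.of_forall fun z => ?_)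
  simp only
  rw [← neg_mul, mul_pow, mul_pow]
  ring

lemma integral_gaussianReal_prod_half_lt (n r : ℕ) (hr : 0 < r) (γ : ℝ) (hγ : γ ≠ 1 / 2) :
    ∫ z : ℝ × ℝ, z.1 ^ (2 * n) * z.2 ^ (2 * n) *
        ((1 / 2 : ℝ) * z.1 ^ 2 - (1 - 1 / 2) * z.2 ^ 2) ^ (2 * r)
        ∂((gaussianReal 0 1).prod (gaussianReal 0 1)) <
      ∫ z : ℝ × ℝ, z.1 ^ (2 * n) * z.2 ^ (2 * n) *
        (γ * z.1 ^ 2 - (1 - γ) * z.2 ^ 2) ^ (2 * r)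
        ∂((gaussianReal 0 1).prod (gaussianReal 0 1)) := by
  set μ := (gaussianReal 0 1).prod (gaussianReal 0 1) with hμ
  let f : ℝ → ℝ × ℝ → ℝ := fun c z => z.1 ^ (2 * n) * z.2 ^ (2 * n) *
        (c * z.1 ^ 2 - (1 - c) * z.2 ^ 2) ^ (2 * r)
  change ∫ z, f (1 / 2) z ∂μ < ∫ z, f γ z ∂μ
  have hint (c : ℝ) : Integrable (f c) μ := integrable_gaussianReal_prod n r c (1 - c)
  have hsymm : ∫ z, f (1 - γ) z ∂μ = ∫ z, f γ z ∂μ := by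
    rw [hμ, ← integral_prod_swap (f γ)]
    refine integral_congr_ae (Filter.Eventually.of_forall fun z => ?_)
    simp only [f, Prod.fst_swap, Prod.snd_swap]
    rw [← (even_two_mul r).neg_pow]
    ring
  have hconv := (even_two_mul r).strictConvexOn_pow (by omega)
  have hmid (z : ℝ × ℝ) (hz : z.1 ≠ 0 ∧ z.2 ≠ 0) :
      0 < f γ z + f (1 - γ) z - 2 * f (1 / 2) z := by
    obtain ⟨h1, h2⟩ := hz
    have hne : γ * z.1 ^ 2 - (1 - γ) * z.2 ^ 2 ≠
        (1 - γ) * z.1 ^ 2 - (1 - (1 - γ)) * z.2 ^ 2 := by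
      intro h
      have h0 : (γ - 1 / 2) * (z.1 ^ 2 + z.2 ^ 2) = 0 := by linarith
      rcases mul_eq_zero.1 h0 with h | h
      · exact hγ (by linarith)
      · have : 0 < z.1 ^ 2 + z.2 ^ 2 := by positivity
        linarith
    have h := hconv.2 (Set.mem_univ _) (Set.mem_univ _) hne
      (show (0 : ℝ) < 1 / 2 by norm_num) (show (0 : ℝ) < 1 / 2 by norm_num) (by norm_num)
    simp only [smul_eq_mul] at h
    rw [show 1 / 2 * (γ * z.1 ^ 2 - (1 - γ) * z.2 ^ 2) +
        1 / 2 * ((1 - γ) * z.1 ^ 2 - (1 - (1 - γ)) * z.2 ^ 2) =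
        1 / 2 * z.1 ^ 2 - (1 - 1 / 2) * z.2 ^ 2 by ring] at h
    have hpos : 0 < z.1 ^ (2 * n) * z.2 ^ (2 * n) :=
      mul_pos ((even_two_mul n).pow_pos h1) ((even_two_mul n).pow_pos h2)
    have h' := mul_lt_mul_of_pos_left h hpos
    simp only [f]
    linarith
  have hae : ∀ᵐ z ∂μ, z.1 ≠ 0 ∧ z.2 ≠ 0 := by
    have : NullSingletonClass (gaussianReal 0 1) :=
      nullSingletonClass_gaussianReal one_ne_zero
    have h0 : ∀ᵐ x ∂(gaussianReal 0 1), x ≠ 0 := Measure.ae_ne _ _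
    exact (Measure.quasiMeasurePreserving_fst.ae h0).and
      (Measure.quasiMeasurePreserving_snd.ae h0)
  have hD : Integrable (fun z => f γ z + f (1 - γ) z - 2 * f (1 / 2) z) μ :=
    ((hint _).add (hint _)).sub ((hint _).const_mul 2)
  have hpos : 0 < ∫ z, f γ z + f (1 - γ) z - 2 * f (1 / 2) z ∂μ := by
    rw [integral_pos_iff_support_of_nonneg_ae
      (hae.mono fun z hz => (hmid z hz).le) hD]
    have hs : Function.support (fun z => f γ z + f (1 - γ) z - 2 * f (1 / 2) z) =ᵐ[μ] Set.univ :=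
      Filter.eventuallyEq_univ.2 (hae.mono fun z hz => (hmid z hz).ne')
    rw [measure_congr hs, measure_univ]
    exact one_pos
  have hadd : Integrable (fun z => f γ z + f (1 - γ) z) μ := (hint _).add (hint _)
  rw [integral_sub hadd ((hint _).const_mul 2), integral_add (hint _) (hint _),
    integral_const_mul, hsymm] at hpos
  linarith

/-- For independent standard Gaussians `U, V`, a nonnegative integer `n`, a positive
integer `r`, and `γ ∈ (0,1)` with `γ ≠ 1/2`:
`E[U^{2n} V^{2n} (γU² - (1-γ)V²)^{2r}] > 2^{2n+2r} (1/2)_n (1/2)_{n+r} (1/2)_r`;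
that is, `γ ↦ E[U^{2n} V^{2n} (γU² - (1-γ)V²)^{2r}]` attains its unique minimum on
`(0,1)` at `γ = 1/2`, where its value is `2^{2n+2r} (1/2)_n (1/2)_{n+r} (1/2)_r`. -/
theorem gaussian_symmetric_moment_strict_min
    {Ω : Type*} [MeasurableSpace Ω] (P : Measure Ω) [IsProbabilityMeasure P]
    (U V : Ω → ℝ)
    (hU : Measure.map U P = gaussianReal 0 1)
    (hV : Measure.map V P = gaussianReal 0 1)
    (hindep : IndepFun U V P)
    (n r : ℕ) (hr : 0 < r) :
    (∀ γ : ℝ, 0 < γ → γ < 1 → γ ≠ 1 / 2 →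
      (∫ ω, (U ω) ^ (2 * n) * (V ω) ^ (2 * n) *
          (γ * (U ω) ^ 2 - (1 - γ) * (V ω) ^ 2) ^ (2 * r) ∂P)
        > 2 ^ (2 * n + 2 * r) * risingFactorial (1 / 2) n *
            risingFactorial (1 / 2) (n + r) * risingFactorial (1 / 2) r)
    ∧ (∫ ω, (U ω) ^ (2 * n) * (V ω) ^ (2 * n) *
          ((1 / 2 : ℝ) * (U ω) ^ 2 - (1 - 1 / 2) * (V ω) ^ 2) ^ (2 * r) ∂P)
        = 2 ^ (2 * n + 2 * r) * risingFactorial (1 / 2) n *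
            risingFactorial (1 / 2) (n + r) * risingFactorial (1 / 2) r := by
  have hUm : AEMeasurable U P := aemeasurable_of_map_neZero (by rw [hU]; infer_instance)
  have hVm : AEMeasurable V P := aemeasurable_of_map_neZero (by rw [hV]; infer_instance)
  have hmap := (indepFun_iff_map_prod_eq_prod_map_map hUm hVm).1 hindep
  rw [hU, hV] at hmap
  have key (c : ℝ) : ∫ ω, (U ω) ^ (2 * n) * (V ω) ^ (2 * n) *
      (c * (U ω) ^ 2 - (1 - c) * (V ω) ^ 2) ^ (2 * r) ∂P =
      ∫ z : ℝ × ℝ, z.1 ^ (2 * n) * z.2 ^ (2 * n) *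
        (c * z.1 ^ 2 - (1 - c) * z.2 ^ 2) ^ (2 * r)
        ∂((gaussianReal 0 1).prod (gaussianReal 0 1)) := by
    rw [← hmap, integral_map (hUm.prodMk hVm)
      (Continuous.aestronglyMeasurable (by fun_prop))]
  refine ⟨fun γ _ _ hγ => ?_, ?_⟩
  · rw [key, gt_iff_lt, ← integral_gaussianReal_prod_half]
    exact integral_gaussianReal_prod_half_lt n r hr γ hγ
  · rw [key, integral_gaussianReal_prod_half]
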